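/- For every finite metric space G = (V,d) with |V| ≥ 2 and every vertex v₀ ∈ V, there exists a weight function w : V → ℝ≥0 with w(v₀) = 0 such that: (1) Σ_{v∈V} w(v) = MST(G); and (2) for every subset V' ⊆ V with v₀ ∈ V', Σ_{v∈V'} w(v) ≤ Steiner_G(V'). -/

import Mathlib

/-- The total `dist`-weight of the edges of a graph on a metric space. -/
noncomputable def graphWeight {V : Type} [MetricSpace V] (G : SimpleGraph V) : ℝ :=
  ∑ᶠ e ∈ G.edgeSet, Sym2.lift ⟨fun a b => dist a b, fun a b => dist_comm a b⟩ e

/-- The weight of a minimum spanning tree of the complete graph on the finite metric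
space `V`, with edge weights given by the distances. -/
noncomputable def MSTweight (V : Type) [MetricSpace V] : ℝ :=
  sInf {x | ∃ T : SimpleGraph V, T.IsTree ∧ x = graphWeight T}

/-- The minimum weight of a Steiner tree for the terminal set `V'`: the minimum, over
vertex sets `U` with `V' ⊆ U ⊆ V` and trees `T` on `U`, of the total weight of `T`. -/
noncomputable def SteinerWeight (V : Type) [MetricSpace V] (V' : Set V) : ℝ :=
  sInf {x | ∃ U : Set V, V' ⊆ U ∧ ∃ T : SimpleGraph U, T.IsTree ∧ x = graphWeight T}

section GraphWeight

/-- The length of an edge of a graph on a metric space. -/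
noncomputable def edgeLength {V : Type} [MetricSpace V] : Sym2 V → ℝ :=
  Sym2.lift ⟨fun a b => dist a b, fun a b => dist_comm a b⟩

@[simp]
lemma edgeLength_mk {V : Type} [MetricSpace V] (a b : V) : edgeLength s(a, b) = dist a b := rfl

lemma edgeLength_nonneg {V : Type} [MetricSpace V] (e : Sym2 V) : 0 ≤ edgeLength e := by
  induction e with | _ a b => exact dist_nonneg

lemma graphWeight_eq_sum {V : Type} [MetricSpace V] (G : SimpleGraph V) [Fintype G.edgeSet] :
    graphWeight G = ∑ e ∈ G.edgeFinset, edgeLength e := by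
  rw [← finsum_mem_coe_finset, SimpleGraph.coe_edgeFinset]
  rfl

lemma graphWeight_nonneg {V : Type} [MetricSpace V] (G : SimpleGraph V) : 0 ≤ graphWeight G :=
  finsum_nonneg fun e => finsum_nonneg fun _ => edgeLength_nonneg e

lemma graphWeight_mono {V : Type} [Fintype V] [MetricSpace V] {G H : SimpleGraph V} (h : G ≤ H) :
    graphWeight G ≤ graphWeight H := by
  classical
  rw [graphWeight_eq_sum, graphWeight_eq_sum]
  exact Finset.sum_le_sum_of_subset_of_nonneg (SimpleGraph.edgeFinset_mono h)
    fun e _ _ => edgeLength_nonneg e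

lemma graphWeight_sup_le {V : Type} [Fintype V] [MetricSpace V] (G H : SimpleGraph V) :
    graphWeight (G ⊔ H) ≤ graphWeight G + graphWeight H := by
  classical
  rw [graphWeight_eq_sum, graphWeight_eq_sum, graphWeight_eq_sum, SimpleGraph.edgeFinset_sup,
    ← Finset.sum_union_inter]
  exact le_add_of_nonneg_right (Finset.sum_nonneg fun e _ => edgeLength_nonneg e)

lemma graphWeight_map_subtype {V : Type} [MetricSpace V] {U : Set V} (T : SimpleGraph U) :
    graphWeight (T.map (Function.Embedding.subtype (· ∈ U))) = graphWeight T := by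
  unfold graphWeight
  rw [SimpleGraph.edgeSet_map,
    finsum_mem_image (Function.Embedding.injective _).injOn]
  refine finsum_mem_congr rfl fun e _ => ?_
  induction e with | _ a b => rfl

/-- The graph joining each point of `s` to its image under `p` weighs at most the total
displacement of `p` on `s`. -/
lemma graphWeight_fromEdgeSet_le {V : Type} [Fintype V] [MetricSpace V] (p : V → V)
    (s : Finset V) :
    graphWeight (SimpleGraph.fromEdgeSet ((fun v => s(v, p v)) '' (s : Set V))) ≤
      ∑ v ∈ s, dist v (p v) := by
  classical
  rw [graphWeight_eq_sum]
  calc _ ≤ ∑ e ∈ s.image fun v => s(v, p v), edgeLength e := by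
        refine Finset.sum_le_sum_of_subset_of_nonneg (fun e he => ?_)
          fun e _ _ => edgeLength_nonneg e
        simp only [SimpleGraph.mem_edgeFinset, SimpleGraph.edgeSet_fromEdgeSet] at he
        simpa using he.1
    _ ≤ _ := Finset.sum_image_le_of_nonneg (g := fun v => s(v, p v)) (f := edgeLength)
        fun e _ => edgeLength_nonneg e

lemma MSTweight_le_graphWeight {V : Type} [Fintype V] [MetricSpace V] {G : SimpleGraph V}
    (hG : G.Connected) : MSTweight V ≤ graphWeight G := by
  obtain ⟨T, hTG, hT⟩ := hG.exists_isTree_le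
  refine (csInf_le (s := {x | ∃ T : SimpleGraph V, T.IsTree ∧ x = graphWeight T}) ⟨0, ?_⟩
    ⟨T, hT, rfl⟩).trans (graphWeight_mono hTG)
  rintro _ ⟨T, -, rfl⟩
  exact graphWeight_nonneg T

lemma exists_isTree_graphWeight_eq_MSTweight (V : Type) [Fintype V] [MetricSpace V] [Nonempty V] :
    ∃ T : SimpleGraph V, T.IsTree ∧ MSTweight V = graphWeight T := by
  obtain ⟨T, -, hT⟩ := (SimpleGraph.connected_top (V := V)).exists_isTree_le
  refine Set.Nonempty.csInf_mem (s := {x | ∃ T : SimpleGraph V, T.IsTree ∧ x = graphWeight T})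
    ⟨_, T, hT, rfl⟩ ((Set.finite_range (graphWeight (V := V))).subset ?_)
  rintro _ ⟨T, -, rfl⟩
  exact ⟨T, rfl⟩

/-- Extending a connected graph on `U ∋ v₀` by the edges joining each vertex outside `U` to its
parent, where parents descend towards `v₀`, spans `V`. -/
lemma MSTweight_le_graphWeight_add {V : Type} [Fintype V] [MetricSpace V] {v₀ : V} {p : V → V}
    {rank : V → ℕ} (hp : ∀ v, v ≠ v₀ → rank (p v) < rank v) {U : Set V} (hU : v₀ ∈ U)
    {T : SimpleGraph U} (hT : T.Connected) {s : Finset V} (hs : ∀ v, v ∈ s ↔ v ∉ U) :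
    MSTweight V ≤ graphWeight T + ∑ v ∈ s, dist v (p v) := by
  set A := T.map (Function.Embedding.subtype (· ∈ U))
  set B := SimpleGraph.fromEdgeSet ((fun v => s(v, p v)) '' (s : Set V))
  have hreach : ∀ n, ∀ v, rank v = n → (A ⊔ B).Reachable v v₀ := by
    intro n
    induction n using Nat.strong_induction_on with
    | _ n ih =>
      rintro v rfl
      by_cases hv : v ∈ U
      · have h : A.Reachable v v₀ :=
          (hT.preconnected ⟨v, hv⟩ ⟨v₀, hU⟩).map (SimpleGraph.Embedding.map _ T).toHom
        exact h.mono le_sup_left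
      · have hlt := hp v (fun h => hv (h ▸ hU))
        have hadj : B.Adj v (p v) :=
          (SimpleGraph.fromEdgeSet_adj _).2
            ⟨⟨v, (hs v).2 hv, rfl⟩, fun h => hlt.ne (congrArg rank h.symm)⟩
        exact (SimpleGraph.Adj.reachable (Or.inr hadj)).trans (ih _ hlt _ rfl)
  have hconn : (A ⊔ B).Connected :=
    SimpleGraph.connected_iff_exists_forall_reachable _ |>.2
      ⟨v₀, fun v => (hreach _ v rfl).symm⟩
  calc MSTweight V ≤ graphWeight (A ⊔ B) := MSTweight_le_graphWeight hconn
    _ ≤ graphWeight A + graphWeight B := graphWeight_sup_le A B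
    _ ≤ _ := add_le_add (graphWeight_map_subtype T).le (graphWeight_fromEdgeSet_le p s)

/-- In a graph, the edges from vertices to parents of smaller rank are pairwise distinct. -/
lemma sum_dist_parent_le_graphWeight {V : Type} [Fintype V] [MetricSpace V] {G : SimpleGraph V}
    {p : V → V} {rank : V → ℕ} {s : Finset V} (hadj : ∀ v ∈ s, G.Adj v (p v))
    (hp : ∀ v ∈ s, rank (p v) < rank v) : ∑ v ∈ s, dist v (p v) ≤ graphWeight G := by
  classical
  have hinj : Set.InjOn (fun v => s(v, p v)) (s : Set V) := by
    intro u hu v hv huv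
    rcases Sym2.eq_iff.1 huv with h | ⟨h₁, h₂⟩
    · exact h.1
    · have hu' := hp u hu
      have hv' := hp v hv
      rw [h₂] at hu'
      rw [← h₁] at hv'
      omega
  rw [graphWeight_eq_sum]
  calc _ = ∑ e ∈ s.image fun v => s(v, p v), edgeLength e := by
        rw [Finset.sum_image hinj]; rfl
    _ ≤ _ := by
        refine Finset.sum_le_sum_of_subset_of_nonneg (fun e he => ?_)
          fun e _ _ => edgeLength_nonneg e
        obtain ⟨v, hv, rfl⟩ := Finset.mem_image.1 he
        simpa using hadj v hv

lemma SimpleGraph.Connected.exists_adj_dist_lt {V : Type*} {G : SimpleGraph V}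
    (hG : G.Connected) {v v₀ : V} (hv : v ≠ v₀) : ∃ u, G.Adj v u ∧ G.dist u v₀ < G.dist v v₀ := by
  obtain ⟨q, hq⟩ := hG.exists_walk_length_eq_dist v v₀
  cases q with
  | nil => exact absurd rfl hv
  | cons h q =>
    refine ⟨_, h, ?_⟩
    have := SimpleGraph.dist_le q
    rw [SimpleGraph.Walk.length_cons] at hq
    omega

end GraphWeight

/-- Embedding a finite metric space into a star metric: for any base point `v₀` there
are nonnegative leaf weights `w` with `w v₀ = 0` whose total is `MST(G)` and such that
for every terminal set `V'` containing `v₀`, the star weight of `V'` is at most the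
Steiner tree weight of `V'` in `G`. -/
theorem metric_to_star_embedding
    (V : Type) [Fintype V] [MetricSpace V] (v₀ : V) (hV : 2 ≤ Fintype.card V) :
    ∃ w : V → ℝ,
      (∀ v, 0 ≤ w v) ∧
      w v₀ = 0 ∧
      (∑ v, w v) = MSTweight V ∧
      ∀ V' : Set V, v₀ ∈ V' → (∑ᶠ v ∈ V', w v) ≤ SteinerWeight V V' := by
  classical
  have : Nonempty V := ⟨v₀⟩
  obtain ⟨T, hT, hTw⟩ := exists_isTree_graphWeight_eq_MSTweight V
  choose! p hadj hrank using fun v (hv : v ≠ v₀) => hT.connected.exists_adj_dist_lt hv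
  set w : V → ℝ := fun v => if v = v₀ then 0 else dist v (p v) with hw
  have hw0 : ∀ v, 0 ≤ w v := fun v => by
    rw [hw]; dsimp only; split_ifs <;> [exact le_rfl; exact dist_nonneg]
  have hw_sum : ∀ s : Finset V, v₀ ∉ s → ∑ v ∈ s, w v = ∑ v ∈ s, dist v (p v) := fun s hs =>
    Finset.sum_congr rfl fun v hv => if_neg fun h : v = v₀ => hs (h ▸ hv)
  have hsplit : ∀ (U : Set V) (S : SimpleGraph U), v₀ ∈ U → S.Connected →
      MSTweight V ≤ graphWeight S + ∑ v ∈ Finset.univ.filter (· ∉ U), w v := by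
    intro U S hU hS
    rw [hw_sum _ (by simpa using hU)]
    exact MSTweight_le_graphWeight_add (rank := fun v => T.dist v v₀) hrank hU hS (by simp)
  have hw_erase : ∑ v, w v = ∑ v ∈ Finset.univ.erase v₀, dist v (p v) := by
    rw [← hw_sum _ (by simp), Finset.sum_erase (f := w) _ (if_pos rfl)]
  have htotal : ∑ v, w v = MSTweight V := by
    apply le_antisymm
    · rw [hTw, hw_erase]
      exact sum_dist_parent_le_graphWeight (rank := fun v => T.dist v v₀)
        (fun v hv => hadj v (Finset.ne_of_mem_erase hv))
        (fun v hv => hrank v (Finset.ne_of_mem_erase hv))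
    · have hconn : (⊥ : SimpleGraph ({v₀} : Set V)).Connected :=
        { preconnected := fun a b => by rw [Subsingleton.elim a b] }
      have hbot : graphWeight (⊥ : SimpleGraph ({v₀} : Set V)) = 0 := by simp [graphWeight]
      have h := hsplit {v₀} ⊥ rfl hconn
      rw [hbot, zero_add] at h
      exact h.trans (Finset.sum_le_sum_of_subset_of_nonneg (Finset.filter_subset _ _)
        fun v _ _ => hw0 v)
  refine ⟨w, hw0, if_pos rfl, htotal, fun V' hV' => le_csInf ?_ ?_⟩
  · have : Nonempty (Set.univ : Set V) := ⟨⟨v₀, trivial⟩⟩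
    obtain ⟨S, -, hS⟩ :=
      (SimpleGraph.connected_top (V := (Set.univ : Set V))).exists_isTree_le
    exact ⟨_, Set.univ, Set.subset_univ _, S, hS, rfl⟩
  · rintro _ ⟨U, hVU, S, hS, rfl⟩
    have h := hsplit U S (hVU hV') hS.connected
    rw [← htotal, ← Finset.sum_filter_add_sum_filter_not Finset.univ (· ∈ U) w] at h
    have hle : ∑ᶠ v ∈ V', w v ≤ ∑ v ∈ Finset.univ.filter (· ∈ U), w v := by
      rw [finsum_mem_eq_toFinset_sum]
      refine Finset.sum_le_sum_of_subset_of_nonneg (fun v hv => ?_) fun v _ _ => hw0 v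
      simpa using hVU (Set.mem_toFinset.1 hv)
    linarith
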